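/- arXiv:1306.4553 — 2 statements merged into one kernel-verified Lean document; each statement's English description precedes it below -/
import Mathlib

section
/- Let k, n be positive integers with k < n, and let p₀,…,p_k ∈ ℝ^{1,n} be (k+1) points in general position. Then the Lorentzian distance-squared mapping L_{(p₀,…,p_k)} : ℝ^{1,n} → ℝ^{k+1} is A-equivalent to the mapping (x₀,…,xₙ) ↦ (x₁,…,x_k, x₀x₁ + Σ_{i=k+1}^n x_i²) if and only if the recognition subspace V(p₀,…,p_k) is light-like. -/
open scoped BigOperators

noncomputable section

/-- The Lorentzian inner product on `ℝ^{1,n}`, modeled as `Fin (n+1) → ℝ`: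
`⟨x,y⟩ = -x₀y₀ + x₁y₁ + ⋯ + xₙyₙ`. -/
def lorIP {n : ℕ} (x y : Fin (n + 1) → ℝ) : ℝ :=
  (∑ i, x i * y i) - 2 * (x 0 * y 0)

/-- The Euclidean inner product on `Fin m → ℝ`. -/
def eucIP {m : ℕ} (x y : Fin m → ℝ) : ℝ := ∑ i, x i * y i

/-- The Lorentzian distance-squared mapping determined by the points `p 0, …, p (m-1)`. -/
def LorDSM {n m : ℕ} (p : Fin m → Fin (n + 1) → ℝ) :
    (Fin (n + 1) → ℝ) → (Fin m → ℝ) :=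
  fun x i => lorIP (x - p i) (x - p i)

/-- The Euclidean distance-squared mapping determined by the points `p 0, …, p (m-1)`. -/
def EucDSM {n m : ℕ} (p : Fin m → Fin (n + 1) → ℝ) :
    (Fin (n + 1) → ℝ) → (Fin m → ℝ) :=
  fun x i => eucIP (x - p i) (x - p i)

/-- The recognition subspace `V(p₀, …, p_k)`: the span of the vectors `p i - p 0`. -/
def recSub {n k : ℕ} (p : Fin (k + 1) → Fin (n + 1) → ℝ) :
    Submodule ℝ (Fin (n + 1) → ℝ) :=
  Submodule.span ℝ (Set.range fun i => p i - p 0)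

/-- The partial recognition subspace `V(p₀, …, p_j)`: the span of `p i - p 0` for `i ≤ j`. -/
def recSubUpTo {n k : ℕ} (p : Fin (k + 1) → Fin (n + 1) → ℝ) (j : ℕ) :
    Submodule ℝ (Fin (n + 1) → ℝ) :=
  Submodule.span ℝ {v | ∃ i : Fin (k + 1), (i : ℕ) ≤ j ∧ v = p i - p 0}

/-- A subspace is time-like iff it contains a vector of negative Lorentzian square. -/
def LTimeLike {n : ℕ} (V : Submodule ℝ (Fin (n + 1) → ℝ)) : Prop :=
  ∃ v ∈ V, lorIP v v < 0

/-- A subspace is space-like iff every nonzero vector in it has positive Lorentzian square. -/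
def LSpaceLike {n : ℕ} (V : Submodule ℝ (Fin (n + 1) → ℝ)) : Prop :=
  ∀ v ∈ V, v ≠ 0 → 0 < lorIP v v

/-- A subspace is light-like iff it is neither time-like nor space-like. -/
def LLightLike {n : ℕ} (V : Submodule ℝ (Fin (n + 1) → ℝ)) : Prop :=
  ¬ LTimeLike V ∧ ¬ LSpaceLike V

/-- `f` and `g` are `𝒜`-equivalent: `g = H ∘ f ∘ h` for `C^∞` diffeomorphisms `h, H`. -/
def AEquiv {a b : ℕ} (f g : (Fin a → ℝ) → (Fin b → ℝ)) : Prop :=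
  ∃ (h : (Fin a → ℝ) ≃ (Fin a → ℝ)) (H : (Fin b → ℝ) ≃ (Fin b → ℝ)),
    ContDiff ℝ (⊤ : ℕ∞) ⇑h ∧ ContDiff ℝ (⊤ : ℕ∞) ⇑h.symm ∧
    ContDiff ℝ (⊤ : ℕ∞) ⇑H ∧ ContDiff ℝ (⊤ : ℕ∞) ⇑H.symm ∧
    g = ⇑H ∘ f ∘ ⇑h

/-- The Lorentzian inner product as a bilinear map. -/
def lorBilin (n : ℕ) : (Fin (n + 1) → ℝ) →ₗ[ℝ] (Fin (n + 1) → ℝ) →ₗ[ℝ] ℝ :=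
  LinearMap.mk₂ ℝ lorIP
    (fun x y z => by
      simp only [lorIP, Pi.add_apply, add_mul, Finset.sum_add_distrib]; ring)
    (fun c x y => by
      simp only [lorIP, Pi.smul_apply, smul_eq_mul, mul_assoc, ← Finset.mul_sum]; ring)
    (fun x y z => by
      simp only [lorIP, Pi.add_apply, mul_add, Finset.sum_add_distrib]; ring)
    (fun c x y => by
      simp only [lorIP, Pi.smul_apply, smul_eq_mul, mul_left_comm _ c, ← Finset.mul_sum]; ring)

theorem lorBilin_apply {n : ℕ} (x y : Fin (n + 1) → ℝ) : lorBilin n x y = lorIP x y := rfl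

theorem lorIP_comm {n : ℕ} (x y : Fin (n + 1) → ℝ) : lorIP x y = lorIP y x := by
  simp only [lorIP, mul_comm]

theorem lorIP_add_smul_self {n : ℕ} (x v : Fin (n + 1) → ℝ) (t : ℝ) :
    lorIP (x + t • v) (x + t • v) = lorIP x x + 2 * t * lorIP x v + t ^ 2 * lorIP v v := by
  have h := lorIP_comm v x
  simp only [← lorBilin_apply, map_add, map_smul, LinearMap.add_apply, LinearMap.smul_apply,
    smul_eq_mul] at h ⊢
  rw [h]; ring

theorem lorIP_sub_self {n : ℕ} (x v : Fin (n + 1) → ℝ) :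
    lorIP (x - v) (x - v) = lorIP x x - 2 * lorIP x v + lorIP v v := by
  have h := lorIP_add_smul_self x v (-1)
  rw [neg_one_smul, ← sub_eq_add_neg] at h
  rw [h]; ring

theorem lorIP_eq_succ {n : ℕ} (x y : Fin (n + 1) → ℝ) :
    lorIP x y = ∑ i : Fin n, x i.succ * y i.succ - x 0 * y 0 := by
  rw [lorIP, Fin.sum_univ_succ]; ring

theorem eq_zero_of_forall_lorIP_eq_zero {n : ℕ} {x : Fin (n + 1) → ℝ}
    (hx : ∀ v, lorIP x v = 0) : x = 0 := by
  funext i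
  have h := hx (Pi.single i 1)
  simp only [lorIP, Pi.single_apply, mul_ite, mul_one, mul_zero, Finset.sum_ite_eq',
    Finset.mem_univ, if_true] at h
  split_ifs at h with h0
  · subst h0
    simpa using (by linarith : x 0 = 0)
  · simpa using h

/-- A null vector with vanishing time coordinate is zero. -/
theorem eq_zero_of_lorIP_self_eq_zero {n : ℕ} {v : Fin (n + 1) → ℝ}
    (hv : lorIP v v = 0) (h0 : v 0 = 0) : v = 0 := by
  rw [lorIP_eq_succ, h0, mul_zero, sub_zero,
    Finset.sum_eq_zero_iff_of_nonneg fun i _ => mul_self_nonneg _] at hv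
  funext i
  refine Fin.cases h0 (fun i => ?_) i
  exact mul_self_eq_zero.mp (hv i (Finset.mem_univ i))

/-- A null vector orthogonal to a time-like vector is zero. -/
theorem eq_zero_of_lorIP_eq_zero_of_neg {n : ℕ} {u v : Fin (n + 1) → ℝ}
    (hu : lorIP u u < 0) (hv : lorIP v v = 0) (huv : lorIP u v = 0) : v = 0 := by
  have hu0 : u 0 ≠ 0 := by
    intro h
    rw [lorIP_eq_succ, h, mul_zero, sub_zero] at hu
    exact absurd hu (not_lt.mpr (Finset.sum_nonneg fun i _ => mul_self_nonneg _))
  refine eq_zero_of_lorIP_self_eq_zero hv ?_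
  by_contra hv0
  -- the combination `v₀ u - u₀ v` has no time component, so its square is nonnegative
  have h := lorIP_add_smul_self (v 0 • u) v (-u 0)
  have h1 : 0 ≤ lorIP (v 0 • u + (-u 0) • v) (v 0 • u + (-u 0) • v) := by
    rw [lorIP_eq_succ]
    have : (v 0 • u + (-u 0) • v) 0 = 0 := by simp; ring
    rw [this, mul_zero, sub_zero]
    exact Finset.sum_nonneg fun i _ => mul_self_nonneg _
  rw [h, hv] at h1
  simp only [← lorBilin_apply, map_smul, LinearMap.smul_apply, smul_eq_mul] at h1
  simp only [lorBilin_apply, huv] at h1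
  have h2 : 0 < v 0 * v 0 := mul_self_pos.mpr hv0
  nlinarith

theorem LorDSM_contDiff {n m : ℕ} (p : Fin m → Fin (n + 1) → ℝ) :
    ContDiff ℝ (⊤ : ℕ∞) (LorDSM p) := by
  unfold LorDSM lorIP
  fun_prop

/-- A coordinate of a directional derivative is computed along a line. -/
theorem fderiv_apply_eq_of_hasDerivAt {a b : ℕ} {f : (Fin a → ℝ) → Fin b → ℝ} {x v : Fin a → ℝ}
    (hf : DifferentiableAt ℝ f x) {i : Fin b} {c : ℝ}
    (h : HasDerivAt (fun t : ℝ => f (x + t • v) i) c 0) : fderiv ℝ f x v i = c := by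
  have h1 : HasDerivAt (fun t : ℝ => f (x + t • v)) (fderiv ℝ f x v) 0 :=
    hf.hasFDerivAt.hasLineDerivAt v
  exact (hasDerivAt_pi.mp h1 i).unique h

theorem fderiv_LorDSM_apply {n m : ℕ} (p : Fin m → Fin (n + 1) → ℝ) (x v : Fin (n + 1) → ℝ)
    (i : Fin m) : fderiv ℝ (LorDSM p) x v i = 2 * lorIP (x - p i) v := by
  refine fderiv_apply_eq_of_hasDerivAt ((LorDSM_contDiff p).differentiable (by simp) x) ?_
  have h : (fun t : ℝ => LorDSM p (x + t • v) i) = fun t : ℝ =>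
      lorIP (x - p i) (x - p i) + 2 * t * lorIP (x - p i) v + t ^ 2 * lorIP v v := by
    funext t
    rw [LorDSM, ← lorIP_add_smul_self, add_sub_right_comm]
  rw [h]
  have h1 : HasDerivAt (fun t : ℝ => t) 1 0 := hasDerivAt_id 0
  exact ((((h1.const_mul 2).mul_const (lorIP (x - p i) v)).const_add
    (lorIP (x - p i) (x - p i))).add ((h1.pow 2).mul_const (lorIP v v))).congr_deriv (by simp)

theorem recSub_eq_span_succ {n k : ℕ} (p : Fin (k + 1) → Fin (n + 1) → ℝ) :
    recSub p = Submodule.span ℝ (Set.range fun i : Fin k => p i.succ - p 0) := by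
  apply le_antisymm
  · refine Submodule.span_le.mpr ?_
    rintro _ ⟨i, rfl⟩
    refine Fin.cases ?_ (fun i => ?_) i
    · simp
    · exact Submodule.subset_span ⟨i, rfl⟩
  · refine Submodule.span_mono ?_
    rintro _ ⟨i, rfl⟩
    exact ⟨i.succ, rfl⟩

theorem linearIndependent_sub_of_finrank {n k : ℕ} {p : Fin (k + 1) → Fin (n + 1) → ℝ}
    (hgen : Module.finrank ℝ (recSub p) = k) :
    LinearIndependent ℝ fun i : Fin k => p i.succ - p 0 := by
  rw [linearIndependent_iff_card_eq_finrank_span, Set.finrank, ← recSub_eq_span_succ, hgen,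
    Fintype.card_fin]

theorem sub_mem_recSub {n k : ℕ} (p : Fin (k + 1) → Fin (n + 1) → ℝ) (i : Fin (k + 1)) :
    p i - p 0 ∈ recSub p :=
  Submodule.subset_span ⟨i, rfl⟩

/-- The singular points of a Lorentzian distance-squared mapping determined by points in general
position lie in the affine span of these points. -/
theorem sub_mem_recSub_of_not_surjective {n k : ℕ} {p : Fin (k + 1) → Fin (n + 1) → ℝ}
    (hgen : Module.finrank ℝ (recSub p) = k) {x : Fin (n + 1) → ℝ}
    (hx : ¬ Function.Surjective (fderiv ℝ (LorDSM p) x)) : x - p 0 ∈ recSub p := by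
  have hlt : LinearMap.range (fderiv ℝ (LorDSM p) x).toLinearMap < ⊤ :=
    lt_top_iff_ne_top.mpr fun h => hx (LinearMap.range_eq_top.mp h)
  obtain ⟨c, hc, hmap⟩ := Submodule.exists_dual_map_eq_bot_of_lt_top hlt inferInstance
  set a : Fin (k + 1) → ℝ := fun i => c fun j => if i = j then 1 else 0
  have hca : ∀ y, c y = ∑ i, y i * a i := fun y => by
    rw [LinearMap.pi_apply_eq_sum_univ c y]
    rfl
  have hrel : ∑ i, a i • (x - p i) = 0 := by
    refine eq_zero_of_forall_lorIP_eq_zero fun v => ?_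
    have h : c (fderiv ℝ (LorDSM p) x v) = 0 := by
      have : c (fderiv ℝ (LorDSM p) x v) ∈
          Submodule.map c (LinearMap.range (fderiv ℝ (LorDSM p) x).toLinearMap) :=
        ⟨_, ⟨v, rfl⟩, rfl⟩
      rwa [hmap, Submodule.mem_bot] at this
    simp only [hca, fderiv_LorDSM_apply, mul_assoc, ← Finset.mul_sum] at h
    rw [← lorBilin_apply, map_sum, LinearMap.sum_apply]
    simp only [map_smul, LinearMap.smul_apply, smul_eq_mul, lorBilin_apply]
    simp only [mul_comm (a _)]
    linarith
  have hrel' : (∑ i, a i) • (x - p 0) = ∑ i, a i • (p i - p 0) := by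
    rw [Finset.sum_smul, ← sub_eq_zero, ← Finset.sum_sub_distrib, ← hrel]
    refine Finset.sum_congr rfl fun i _ => ?_
    rw [← smul_sub]; congr 1; abel
  by_cases hs : ∑ i, a i = 0
  · exfalso
    rw [hs, zero_smul, Fin.sum_univ_succ, sub_self, smul_zero, zero_add] at hrel'
    have h0 := Fintype.linearIndependent_iff.mp (linearIndependent_sub_of_finrank hgen)
      (fun i => a i.succ) hrel'.symm
    rw [Fin.sum_univ_succ, Finset.sum_eq_zero fun i _ => h0 i, add_zero] at hs
    refine hc (LinearMap.ext fun y => ?_)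
    rw [hca, Fin.sum_univ_succ, hs]
    simp [h0]
  · rw [← inv_smul_smul₀ hs (x - p 0), hrel']
    exact Submodule.smul_mem _ _ (Submodule.sum_mem _ fun i _ =>
      Submodule.smul_mem _ _ (sub_mem_recSub p i))

/-- A subspace that is not light-like has trivial radical. -/
theorem eq_zero_of_orthogonal_of_not_lightLike {n : ℕ} {V : Submodule ℝ (Fin (n + 1) → ℝ)}
    (hV : ¬ LLightLike V) {v : Fin (n + 1) → ℝ} (hv : v ∈ V) (horth : ∀ w ∈ V, lorIP w v = 0) :
    v = 0 := by
  by_cases ht : LTimeLike V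
  · obtain ⟨u, hu, hneg⟩ := ht
    exact eq_zero_of_lorIP_eq_zero_of_neg hneg (horth v hv) (horth u hu)
  · have hs : LSpaceLike V := by
      by_contra h
      exact hV ⟨ht, h⟩
    by_contra hne
    exact (hs v hv hne).ne' (horth v hv)

/-- If the recognition subspace is not light-like, then the mapping is injective on its singular
set. -/
theorem LorDSM_injOn_singular {n k : ℕ} {p : Fin (k + 1) → Fin (n + 1) → ℝ}
    (hgen : Module.finrank ℝ (recSub p) = k) (hV : ¬ LLightLike (recSub p)) :
    Set.InjOn (LorDSM p) {x | ¬ Function.Surjective (fderiv ℝ (LorDSM p) x)} := by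
  intro x hx y hy hxy
  have hmem : x - y ∈ recSub p := by
    have := (recSub p).sub_mem (sub_mem_recSub_of_not_surjective hgen hx)
      (sub_mem_recSub_of_not_surjective hgen hy)
    rwa [sub_sub_sub_cancel_right] at this
  have hgenr : ∀ i, lorIP (p i - p 0) (x - y) = 0 := by
    intro i
    have hi := congrFun hxy i
    have h0 := congrFun hxy 0
    simp only [LorDSM, lorIP_sub_self] at hi h0
    rw [← lorBilin_apply]
    simp only [map_sub, LinearMap.sub_apply, lorBilin_apply]
    rw [lorIP_comm (p i), lorIP_comm (p i), lorIP_comm (p 0), lorIP_comm (p 0)]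
    linarith
  refine sub_eq_zero.mp (eq_zero_of_orthogonal_of_not_lightLike hV hmem fun w hw => ?_)
  have hle : recSub p ≤ LinearMap.ker ((lorBilin n).flip (x - y)) := by
    refine Submodule.span_le.mpr ?_
    rintro _ ⟨i, rfl⟩
    exact hgenr i
  exact hle hw

theorem fderiv_surjective_of_equiv {a : ℕ} {e : (Fin a → ℝ) ≃ (Fin a → ℝ)}
    (he : ContDiff ℝ (⊤ : ℕ∞) e) (he' : ContDiff ℝ (⊤ : ℕ∞) e.symm) (x : Fin a → ℝ) :
    Function.Surjective (fderiv ℝ e x) := by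
  have h1 := (he.differentiable (by simp) x).hasFDerivAt
  have h2 := (he'.differentiable (by simp) (e x)).hasFDerivAt
  rw [← e.symm_apply_apply x] at h1
  have h3 := h1.comp (e x) h2
  rw [e.symm_apply_apply, e.self_comp_symm] at h3
  have h4 := h3.unique (hasFDerivAt_id (e x))
  exact fun y => ⟨_, DFunLike.congr_fun h4 y⟩

/-- Injectivity on the singular set is preserved by `𝒜`-equivalence. -/
theorem AEquiv.injOn_singular {a b : ℕ} {f g : (Fin a → ℝ) → Fin b → ℝ} (hfg : AEquiv f g)
    (hf : ContDiff ℝ (⊤ : ℕ∞) f)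
    (hinj : Set.InjOn f {x | ¬ Function.Surjective (fderiv ℝ f x)}) :
    Set.InjOn g {x | ¬ Function.Surjective (fderiv ℝ g x)} := by
  obtain ⟨h, H, hh, hh', hH, hH', rfl⟩ := hfg
  have hsing : ∀ x, ¬ Function.Surjective (fderiv ℝ (H ∘ f ∘ h) x) →
      ¬ Function.Surjective (fderiv ℝ f (h x)) := by
    intro x hx hsurj
    apply hx
    have h1 := (hh.differentiable (by simp) x).hasFDerivAt
    have h2 := (hf.differentiable (by simp) (h x)).hasFDerivAt
    have h3 := (hH.differentiable (by simp) (f (h x))).hasFDerivAt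
    have h4 : HasFDerivAt (H ∘ f ∘ h) _ x := h3.comp x (h2.comp x h1)
    rw [h4.fderiv]
    exact (fderiv_surjective_of_equiv hH hH' _).comp
      (hsurj.comp (fderiv_surjective_of_equiv hh hh' x))
  intro x hx y hy hxy
  exact h.injective (hinj (hsing x hx) (hsing y hy) (H.injective hxy))

/-- The normal form `(x₁, …, x_k, x₀x₁ + ∑_{i > k} x_i²)` of the light-like case. -/
def lightNormalForm (k n : ℕ) (hk : 1 ≤ k) (hkn : k < n) : (Fin (n + 1) → ℝ) → Fin (k + 1) → ℝ :=
  fun (x : Fin (n + 1) → ℝ) (i : Fin (k + 1)) =>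
    if h : (i : ℕ) < k then x ⟨(i : ℕ) + 1, by omega⟩
    else x 0 * x ⟨1, by omega⟩ + ∑ j : Fin (n + 1), if k + 1 ≤ (j : ℕ) then x j ^ 2 else 0

theorem lightNormalForm_contDiff (k n : ℕ) (hk : 1 ≤ k) (hkn : k < n) :
    ContDiff ℝ (⊤ : ℕ∞) (lightNormalForm k n hk hkn) := by
  refine contDiff_pi.mpr fun i => ?_
  unfold lightNormalForm
  split_ifs
  · fun_prop
  · refine ContDiff.add (by fun_prop) (ContDiff.sum fun j _ => ?_)
    split_ifs <;> fun_prop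

/-- Every point of the `x₀`-axis is a singular point of the normal form. -/
theorem lightNormalForm_not_surjective (k n : ℕ) (hk : 1 ≤ k) (hkn : k < n) (s : ℝ) :
    ¬ Function.Surjective (fderiv ℝ (lightNormalForm k n hk hkn) (Pi.single 0 s)) := by
  intro hsurj
  obtain ⟨v, hv⟩ := hsurj (Pi.single (Fin.last k) 1)
  have hd := (lightNormalForm_contDiff k n hk hkn).differentiable (by simp) (Pi.single 0 s)
  have h1 : HasDerivAt (fun t : ℝ => t) 1 0 := hasDerivAt_id 0
  have hfirst : fderiv ℝ (lightNormalForm k n hk hkn) (Pi.single 0 s) v 0 = v ⟨1, by omega⟩ := by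
    refine fderiv_apply_eq_of_hasDerivAt hd ?_
    have : (fun t : ℝ => lightNormalForm k n hk hkn (Pi.single 0 s + t • v) 0) =
        fun t => t * v ⟨1, by omega⟩ := by
      funext t
      simp [lightNormalForm, show 0 < k by omega]
    rw [this]
    simpa using h1.mul_const (v ⟨1, by omega⟩)
  have hlast : fderiv ℝ (lightNormalForm k n hk hkn) (Pi.single 0 s) v (Fin.last k) =
      s * v ⟨1, by omega⟩ := by
    refine fderiv_apply_eq_of_hasDerivAt hd ?_
    have : (fun t : ℝ => lightNormalForm k n hk hkn (Pi.single 0 s + t • v) (Fin.last k)) =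
        fun t => s * (t * v ⟨1, by omega⟩) + t ^ 2 * (v 0 * v ⟨1, by omega⟩ +
          ∑ j : Fin (n + 1), if k + 1 ≤ (j : ℕ) then v j ^ 2 else 0) := by
      funext t
      have hsum : (∑ j : Fin (n + 1), if k + 1 ≤ (j : ℕ) then
          (Pi.single 0 s + t • v : Fin (n + 1) → ℝ) j ^ 2 else 0) =
          t ^ 2 * ∑ j : Fin (n + 1), if k + 1 ≤ (j : ℕ) then v j ^ 2 else 0 := by
        rw [Finset.mul_sum]
        refine Finset.sum_congr rfl fun j _ => ?_
        split_ifs with hj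
        · have : j ≠ 0 := by rintro rfl; simp at hj
          simp [this, mul_pow]
        · simp
      simp only [lightNormalForm, Fin.val_last, lt_irrefl, dite_false, hsum]
      simp
      ring
    rw [this]
    exact (((h1.mul_const (v ⟨1, by omega⟩)).const_mul s).add ((h1.pow 2).mul_const
      (v 0 * v ⟨1, by omega⟩ +
        ∑ j : Fin (n + 1), if k + 1 ≤ (j : ℕ) then v j ^ 2 else 0))).congr_deriv (by simp)
  have hk0 : (0 : Fin (k + 1)) ≠ Fin.last k := by
    rw [Ne, Fin.ext_iff]; simp; omega
  rw [hv, Pi.single_eq_of_ne hk0] at hfirst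
  rw [hv, Pi.single_eq_same, ← hfirst, mul_zero] at hlast
  exact one_ne_zero hlast

theorem lightNormalForm_not_injOn_singular (k n : ℕ) (hk : 1 ≤ k) (hkn : k < n) :
    ¬ Set.InjOn (lightNormalForm k n hk hkn)
      {x | ¬ Function.Surjective (fderiv ℝ (lightNormalForm k n hk hkn) x)} := by
  intro h
  have hval : ∀ s : ℝ, lightNormalForm k n hk hkn (Pi.single 0 s) = 0 := by
    intro s
    funext i
    have hsum : (∑ j : Fin (n + 1), if k + 1 ≤ (j : ℕ) then
        (Pi.single 0 s : Fin (n + 1) → ℝ) j ^ 2 else 0) = 0 := by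
      refine Finset.sum_eq_zero fun j _ => ?_
      split_ifs with hj
      · have : j ≠ 0 := by rintro rfl; simp at hj
        simp [this]
      · rfl
    have hsingle : ∀ j (hj : j + 1 < n + 1), (Pi.single 0 s : Fin (n + 1) → ℝ) ⟨j + 1, hj⟩ = 0 :=
      fun j hj => by rw [Pi.single_eq_of_ne (Fin.ne_of_val_ne (Nat.succ_ne_zero j))]
    rw [lightNormalForm]
    split_ifs
    · exact hsingle _ _
    · rw [hsum, hsingle 0, mul_zero, add_zero, Pi.zero_apply]
  have := h (lightNormalForm_not_surjective k n hk hkn 0)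
    (lightNormalForm_not_surjective k n hk hkn 1) ((hval 0).trans (hval 1).symm)
  simpa using congrFun this 0

/-- A light-like subspace contains a vector with time coordinate `1` orthogonal to it. -/
theorem LLightLike.exists_radical {n : ℕ} {V : Submodule ℝ (Fin (n + 1) → ℝ)}
    (hV : LLightLike V) : ∃ v ∈ V, v 0 = 1 ∧ ∀ w ∈ V, lorIP w v = 0 := by
  obtain ⟨ht, hs⟩ := hV
  simp only [LTimeLike, not_exists, not_and, not_lt] at ht
  simp only [LSpaceLike, not_forall, not_lt] at hs
  obtain ⟨v, hv, hne, hle⟩ := hs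
  have hnull : lorIP v v = 0 := le_antisymm hle (ht v hv)
  have hv0 : v 0 ≠ 0 := fun h => hne (eq_zero_of_lorIP_self_eq_zero hnull h)
  have horth : ∀ w ∈ V, lorIP w v = 0 := by
    intro w hw
    by_contra hwv
    have h := ht _ (V.add_mem hw (V.smul_mem (-(lorIP w w + 1) / (2 * lorIP w v)) hv))
    rw [lorIP_add_smul_self, hnull] at h
    have h2 : 2 * (-(lorIP w w + 1) / (2 * lorIP w v)) * lorIP w v = -(lorIP w w + 1) := by
      field_simp
    rw [h2] at h
    linarith
  refine ⟨(v 0)⁻¹ • v, V.smul_mem _ hv, by simp [hv0], fun w hw => ?_⟩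
  rw [← lorBilin_apply, map_smul, lorBilin_apply, horth w hw, smul_zero]

theorem lorIP_eq_inner {n : ℕ} (x y : Fin (n + 1) → ℝ) :
    lorIP x y = inner ℝ (WithLp.toLp 2 x) (WithLp.toLp 2 y) - 2 * (x 0 * y 0) := by
  simp [lorIP, PiLp.inner_apply, mul_comm]

/-- Adapted coordinates for a light-like subspace: a Lorentz transformation `T` that takes
`e₀ + e₁, e₂, …, e_{m+1}` to a basis of the subspace. -/
theorem LLightLike.exists_adapted_basis {n m : ℕ} (hmn : m + 1 < n)
    {V : Submodule ℝ (Fin (n + 1) → ℝ)} (hV : LLightLike V)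
    (hdim : Module.finrank ℝ V = m + 1) :
    ∃ (T : (Fin (n + 1) → ℝ) ≃ₗ[ℝ] (Fin (n + 1) → ℝ)) (b : Module.Basis (Fin (m + 1)) ℝ V),
      (∀ x y, lorIP (T x) (T y) = lorIP x y) ∧
      ∀ (j : Fin (m + 1)) x, lorIP (T x) (b j) =
        x ⟨(j : ℕ) + 1, by omega⟩ - if j = 0 then x 0 else 0 := by
  obtain ⟨v, hvV, hv0, horth⟩ := hV.exists_radical
  let e := WithLp.linearEquiv 2 ℝ (Fin (n + 1) → ℝ)
  let V' : Submodule ℝ (EuclideanSpace ℝ (Fin (n + 1))) := V.comap e.toLinearMap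
  have hV' : Module.finrank ℝ V' = m + 1 := by
    rw [← hdim]
    exact (e.submoduleMap V').finrank_eq.trans (by
      rw [Submodule.map_comap_eq_of_surjective e.surjective])
  let φ : Module.Dual ℝ V' := (LinearMap.proj 0 : (Fin (n + 1) → ℝ) →ₗ[ℝ] ℝ) ∘ₗ
    e.toLinearMap ∘ₗ V'.subtype
  have hφ : φ ≠ 0 := by
    intro h
    have : φ ⟨WithLp.toLp 2 v, hvV⟩ = 1 := hv0
    rw [h] at this
    exact zero_ne_one this
  have hK : Module.finrank ℝ (LinearMap.ker φ) = m := by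
    have := Module.Dual.finrank_ker_add_one_of_ne_zero hφ
    omega
  let z := (stdOrthonormalBasis ℝ (LinearMap.ker φ)).reindex (finCongr hK)
  let zE : Fin m → EuclideanSpace ℝ (Fin (n + 1)) := fun j => ((z j : V') : EuclideanSpace ℝ _)
  have hzV : ∀ j, (zE j).ofLp ∈ V := fun j => (z j : V').2
  have hz0 : ∀ j, (zE j).ofLp 0 = 0 := fun j => (z j).2
  have hzE : Orthonormal ℝ zE := by
    have h1 := z.orthonormal.comp_linearIsometry (LinearMap.ker φ).subtypeₗᵢ
    exact h1.comp_linearIsometry V'.subtypeₗᵢ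
  let e0 : EuclideanSpace ℝ (Fin (n + 1)) := EuclideanSpace.single 0 1
  let vE : EuclideanSpace ℝ (Fin (n + 1)) := WithLp.toLp 2 v
  have he0 : ∀ x : EuclideanSpace ℝ (Fin (n + 1)), inner ℝ e0 x = x.ofLp 0 := fun x => by
    simp [e0, EuclideanSpace.inner_single_left]
  have hvz : ∀ j, inner ℝ vE (zE j) = 0 := by
    intro j
    have h := horth _ (hzV j)
    rw [lorIP_comm, lorIP_eq_inner, hz0] at h
    simpa using h
  have hvv : inner ℝ vE vE = (2 : ℝ) := by
    have h := horth v hvV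
    rw [lorIP_eq_inner, hv0] at h
    linarith
  have hvE0 : vE.ofLp 0 = 1 := hv0
  have he0e0 : inner ℝ e0 e0 = (1 : ℝ) := by rw [he0]; simp [e0]
  have hG : Orthonormal ℝ (Matrix.vecCons e0 (Matrix.vecCons (vE - e0) zE)) := by
    rw [orthonormal_vecCons_iff, orthonormal_vecCons_iff]
    refine ⟨by simp [e0], fun i => ?_, ?_, fun j => ?_, hzE⟩
    · refine Fin.cases ?_ (fun j => ?_) i
      · rw [Matrix.cons_val_zero, inner_sub_right, he0e0, he0, hvE0, sub_self]
      · rw [Matrix.cons_val_succ, he0, hz0]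
    · have h : inner ℝ (vE - e0) (vE - e0) = (1 : ℝ) := by
        rw [inner_sub_left, inner_sub_right, inner_sub_right, hvv, he0e0, he0,
          real_inner_comm, he0, hvE0]
        norm_num
      rw [real_inner_self_eq_norm_sq] at h
      nlinarith [norm_nonneg (vE - e0)]
    · rw [inner_sub_left, hvz, he0, hz0, sub_self]
  let F : Fin (n + 1) → EuclideanSpace ℝ (Fin (n + 1)) := fun i =>
    if h : (i : ℕ) < m + 2 then Matrix.vecCons e0 (Matrix.vecCons (vE - e0) zE) ⟨i, h⟩ else 0
  have hF : Orthonormal ℝ (Set.domRestrict {i : Fin (n + 1) | (i : ℕ) < m + 2} F) := by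
    have h := hG.comp (fun i : {i : Fin (n + 1) | (i : ℕ) < m + 2} => ⟨i.1, i.2⟩) (by
      intro i j hij
      simpa [Fin.ext_iff, Subtype.ext_iff] using hij)
    convert h using 1
    funext i
    exact dif_pos i.2
  obtain ⟨b, hb⟩ := hF.exists_orthonormalBasis_extension_of_card_eq (by simp)
  have hb' : ∀ i : Fin (m + 2), b ⟨i, by omega⟩ =
      Matrix.vecCons e0 (Matrix.vecCons (vE - e0) zE) i := by
    intro i
    rw [hb ⟨i, by omega⟩ i.2]
    exact dif_pos i.2
  let T : (Fin (n + 1) → ℝ) ≃ₗ[ℝ] (Fin (n + 1) → ℝ) :=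
    e.symm ≪≫ₗ b.repr.symm.toLinearEquiv ≪≫ₗ e
  have hT : ∀ x, WithLp.toLp 2 (T x) = b.repr.symm (WithLp.toLp 2 x) := fun x => rfl
  have hTb : ∀ i x, inner ℝ (b i) (WithLp.toLp 2 (T x)) = x i := fun i x => by
    rw [hT, ← b.repr_apply_apply, LinearIsometryEquiv.apply_symm_apply]
  have hT0 : ∀ x, (T x) 0 = x 0 := fun x => by
    have h := hTb 0 x
    have hb0 : b 0 = e0 := hb' 0
    rwa [hb0, he0] at h
  let β : Fin (m + 1) → V := Matrix.vecCons ⟨v, hvV⟩ fun j => ⟨(zE j).ofLp, hzV j⟩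
  have hTβ : ∀ (j : Fin (m + 1)) x, lorIP (T x) (β j) =
      x ⟨(j : ℕ) + 1, by omega⟩ - if j = 0 then x 0 else 0 := by
    intro j x
    have h1 := hTb ⟨(j : ℕ) + 1, by omega⟩ x
    have h2 : b ⟨(j : ℕ) + 1, by omega⟩ = Matrix.vecCons (vE - e0) zE j := hb' j.succ
    rw [h2] at h1
    rw [lorIP_comm, lorIP_eq_inner, hT0]
    revert h1
    refine Fin.cases (fun h1 => ?_) (fun j h1 => ?_) j
    · rw [Matrix.cons_val_zero, inner_sub_left, he0] at h1
      change inner ℝ vE (WithLp.toLp 2 (T x)) - T x 0 = _ at h1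
      rw [hT0] at h1
      change inner ℝ vE (WithLp.toLp 2 (T x)) - 2 * (v 0 * x 0) = _
      rw [hv0, ← h1, if_pos rfl]
      ring
    · rw [Matrix.cons_val_succ] at h1
      change inner ℝ (zE j) (WithLp.toLp 2 (T x)) - 2 * ((zE j).ofLp 0 * x 0) = _
      rw [hz0, h1, if_neg (Fin.succ_ne_zero j)]
      ring
  have hβ : LinearIndependent ℝ β := by
    rw [Fintype.linearIndependent_iff]
    intro c hc j
    have h := congrArg (fun w : V => lorBilin n (T (Pi.single ⟨(j : ℕ) + 1, by omega⟩ 1)) w) hc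
    simp only [Submodule.coe_sum, Submodule.coe_smul, map_sum, map_smul, lorBilin_apply, hTβ,
      Submodule.coe_zero] at h
    have hzero : ∀ w, lorIP w (0 : Fin (n + 1) → ℝ) = 0 := fun w => map_zero (lorBilin n w)
    have h0 : (Pi.single ⟨(j : ℕ) + 1, by omega⟩ 1 : Fin (n + 1) → ℝ) 0 = 0 :=
      Pi.single_eq_of_ne (by rw [Ne, Fin.ext_iff]; simp) 1
    rw [hzero, Finset.sum_eq_single j] at h
    · simpa [h0] using h
    · intro i _ hij
      rw [h0, ite_self, sub_zero, Pi.single_eq_of_ne, smul_zero]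
      simpa [Fin.ext_iff] using hij
    · simp
  refine ⟨T, basisOfLinearIndependentOfCardEqFinrank hβ (by simp [hdim]), fun x y => ?_, ?_⟩
  · rw [lorIP_eq_inner, hT, hT, LinearIsometryEquiv.inner_map_map, hT0, hT0, ← lorIP_eq_inner]
  · simpa using hTβ

/-- The linear change of coordinates introducing light-cone coordinates in the first two
variables. -/
def lightConeEquiv (N : ℕ) : (Fin (N + 2) → ℝ) ≃ (Fin (N + 2) → ℝ) where
  toFun x := Fin.cons ((x 0 - x 1) / 2) (Fin.cons ((x 0 + x 1) / 2) fun i => x i.succ.succ)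
  invFun c := Fin.cons (c 0 + c 1) (Fin.cons (c 1 - c 0) fun i => c i.succ.succ)
  left_inv x := by
    funext i
    refine Fin.cases ?_ (fun i => Fin.cases ?_ (fun i => ?_) i) i
    · simp; ring
    · simp; ring
    · simp
  right_inv c := by
    funext i
    refine Fin.cases ?_ (fun i => Fin.cases ?_ (fun i => ?_) i) i
    · simp; ring
    · simp; ring
    · simp

theorem lightConeEquiv_contDiff (N : ℕ) : ContDiff ℝ (⊤ : ℕ∞) (lightConeEquiv N) := by
  refine contDiff_pi.mpr fun i => ?_
  refine Fin.cases ?_ (fun i => Fin.cases ?_ (fun i => ?_) i) i <;>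
  · simp only [lightConeEquiv, Equiv.coe_fn_mk, Fin.cons_zero, Fin.cons_succ]
    fun_prop

theorem lightConeEquiv_symm_contDiff (N : ℕ) :
    ContDiff ℝ (⊤ : ℕ∞) (lightConeEquiv N).symm := by
  refine contDiff_pi.mpr fun i => ?_
  refine Fin.cases ?_ (fun i => Fin.cases ?_ (fun i => ?_) i) i <;>
  · simp only [lightConeEquiv, Equiv.coe_fn_symm_mk, Fin.cons_zero, Fin.cons_succ]
    fun_prop

theorem lorIP_lightConeEquiv_self {N : ℕ} (x : Fin (N + 2) → ℝ) :
    lorIP (lightConeEquiv N x) (lightConeEquiv N x) =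
      x 0 * x 1 + ∑ i : Fin N, x i.succ.succ ^ 2 := by
  rw [lorIP_eq_succ, Fin.sum_univ_succ]
  simp only [lightConeEquiv, Equiv.coe_fn_mk, Fin.cons_zero, Fin.cons_succ, ← sq]
  ring

/-- The change of coordinates in the target: it recovers `⟨y, w i⟩` from the values
`⟨y, y⟩` and `⟨y - w i, y - w i⟩` (where `c i = ⟨w i, w i⟩`), applies the linear map `G` to them
and removes the squares of all but the first coordinate from `⟨y, y⟩`. -/
def targetEquiv {m : ℕ} (c : Fin (m + 1) → ℝ) (G : (Fin (m + 1) → ℝ) ≃ₗ[ℝ] (Fin (m + 1) → ℝ)) :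
    (Fin (m + 2) → ℝ) ≃ (Fin (m + 2) → ℝ) where
  toFun z := Fin.snoc (α := fun _ => ℝ) (G fun i => (z 0 - z i.succ + c i) / 2)
    (z 0 - ∑ j : Fin m, G (fun i => (z 0 - z i.succ + c i) / 2) j.succ ^ 2)
  invFun y := Fin.cons (y (Fin.last _) + ∑ j : Fin m, y j.succ.castSucc ^ 2) fun i =>
    y (Fin.last _) + ∑ j : Fin m, y j.succ.castSucc ^ 2
      - 2 * G.symm (fun l => y l.castSucc) i + c i
  left_inv z := by
    funext i
    refine Fin.cases ?_ (fun i => ?_) i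
    · simp only [Fin.cons_zero, Fin.snoc_last, Fin.snoc_castSucc]; ring
    · simp only [Fin.cons_succ, Fin.snoc_last, Fin.snoc_castSucc,
        LinearEquiv.symm_apply_apply]; ring
  right_inv y := by
    have h : (fun i => (y (Fin.last _) + ∑ j : Fin m, y j.succ.castSucc ^ 2 -
        (y (Fin.last _) + ∑ j : Fin m, y j.succ.castSucc ^ 2
          - 2 * G.symm (fun l => y l.castSucc) i + c i) + c i) / 2) =
        G.symm (fun l => y l.castSucc) := by
      funext i; ring
    funext i
    refine Fin.lastCases ?_ (fun i => ?_) i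
    · simp only [Fin.cons_zero, Fin.cons_succ, Fin.snoc_last, h, LinearEquiv.apply_symm_apply]
      ring
    · simp only [Fin.cons_zero, Fin.cons_succ, Fin.snoc_castSucc, h,
        LinearEquiv.apply_symm_apply]

theorem targetEquiv_contDiff {m : ℕ} (c : Fin (m + 1) → ℝ)
    (G : (Fin (m + 1) → ℝ) ≃ₗ[ℝ] (Fin (m + 1) → ℝ)) :
    ContDiff ℝ (⊤ : ℕ∞) (targetEquiv c G) := by
  have hG : ContDiff ℝ (⊤ : ℕ∞) fun z : Fin (m + 2) → ℝ =>
      G fun i => (z 0 - z i.succ + c i) / 2 :=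
    G.toContinuousLinearEquiv.contDiff.comp (by fun_prop)
  have hGi := fun j => contDiff_pi.mp hG j
  refine contDiff_pi.mpr fun i => ?_
  refine Fin.lastCases ?_ (fun i => ?_) i <;>
    simp only [targetEquiv, Equiv.coe_fn_mk, Fin.snoc_last, Fin.snoc_castSucc]
  · exact ContDiff.sub (by fun_prop) (ContDiff.sum fun j _ => (hGi j.succ).pow 2)
  · exact hGi i

theorem targetEquiv_symm_contDiff {m : ℕ} (c : Fin (m + 1) → ℝ)
    (G : (Fin (m + 1) → ℝ) ≃ₗ[ℝ] (Fin (m + 1) → ℝ)) :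
    ContDiff ℝ (⊤ : ℕ∞) (targetEquiv c G).symm := by
  have hG : ContDiff ℝ (⊤ : ℕ∞) fun y : Fin (m + 2) → ℝ => G.symm fun i => y i.castSucc :=
    G.symm.toContinuousLinearEquiv.contDiff.comp (by fun_prop)
  have hGi := fun j => contDiff_pi.mp hG j
  refine contDiff_pi.mpr fun i => ?_
  refine Fin.cases ?_ (fun i => ?_) i <;>
    simp only [targetEquiv, Equiv.coe_fn_symm_mk, Fin.cons_zero, Fin.cons_succ]
  · fun_prop
  · exact ((ContDiff.sub (by fun_prop) (contDiff_const.mul (hGi i)))).add contDiff_const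

theorem sum_fin_eq_add_tail {m N : ℕ} (hmN : m ≤ N) (f : Fin N → ℝ) :
    ∑ i, f i = ∑ j : Fin m, f (Fin.castLE hmN j) +
      ∑ i : Fin N, if m ≤ (i : ℕ) then f i else 0 := by
  obtain ⟨r, rfl⟩ := Nat.exists_eq_add_of_le hmN
  rw [Fin.sum_univ_add f, Fin.sum_univ_add fun i : Fin (m + r) => if m ≤ (i : ℕ) then f i else 0]
  simp only [Fin.val_castAdd, Fin.val_natAdd, not_le.mpr (Fin.is_lt _), if_false,
    Finset.sum_const_zero, zero_add, Nat.le_add_right, if_true]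
  rfl

/-- The light-like case: the mapping is equivalent to the normal form. -/
theorem LLightLike.aEquiv_lightNormalForm {m r : ℕ}
    {p : Fin (m + 2) → Fin (m + r + 3) → ℝ}
    (hgen : Module.finrank ℝ (recSub p) = m + 1) (hV : LLightLike (recSub p)) :
    AEquiv (LorDSM p) (lightNormalForm (m + 1) (m + r + 2) (by omega) (by omega)) := by
  obtain ⟨T, b, hT, hTb⟩ := hV.exists_adapted_basis (by omega : m + 1 < m + r + 2) hgen
  let w : Fin (m + 1) → recSub p := fun i => ⟨p i.succ - p 0, sub_mem_recSub p i.succ⟩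
  have hw : LinearIndependent ℝ w :=
    LinearIndependent.of_comp (recSub p).subtype (linearIndependent_sub_of_finrank hgen)
  let bw := basisOfLinearIndependentOfCardEqFinrank hw (by simp [hgen])
  have hbw : ∀ i, bw i = w i := fun i => by simp [bw]
  let G : (Fin (m + 1) → ℝ) ≃ₗ[ℝ] (Fin (m + 1) → ℝ) := bw.constr ℝ ≪≫ₗ (b.constr ℝ).symm
  have hG : ∀ y : Fin (m + r + 3) → ℝ, (G fun i => lorIP y (w i)) = fun j => lorIP y (b j) := by
    intro y
    have h1 : bw.constr ℝ (fun i => lorIP y (w i)) =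
        (lorBilin (m + r + 2) y) ∘ₗ (recSub p).subtype :=
      bw.ext fun i => by rw [Module.Basis.constr_basis, hbw]; rfl
    rw [LinearEquiv.trans_apply, LinearEquiv.symm_apply_eq, h1]
    exact b.ext fun i => by rw [Module.Basis.constr_basis]; rfl
  refine ⟨(lightConeEquiv (m + r + 1)).trans (T.toEquiv.trans (Equiv.addRight (p 0))),
    targetEquiv (fun i => lorIP (w i : Fin (m + r + 3) → ℝ) (w i)) G, ?_, ?_,
    targetEquiv_contDiff _ _, targetEquiv_symm_contDiff _ _, ?_⟩
  · exact (T.toContinuousLinearEquiv.contDiff.comp (lightConeEquiv_contDiff _)).add contDiff_const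
  · exact (lightConeEquiv_symm_contDiff _).comp (T.symm.toContinuousLinearEquiv.contDiff.comp
      (contDiff_id.add contDiff_const))
  funext x
  set y := T (lightConeEquiv (m + r + 1) x) with hy
  have hyb : ∀ j : Fin (m + 1), lorIP y (b j) = x ⟨(j : ℕ) + 1, by omega⟩ := by
    intro j
    rw [hy, hTb]
    refine Fin.cases ?_ (fun j => ?_) j
    · simp only [lightConeEquiv, Equiv.coe_fn_mk, Fin.val_zero, zero_add, Fin.mk_one, if_true,
        Fin.cons_zero, Fin.cons_one]
      ring
    · rw [if_neg (Fin.succ_ne_zero j), sub_zero]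
      rfl
  have hL0 : LorDSM p (y + p 0) 0 = lorIP y y := by simp [LorDSM]
  have hLs : ∀ i : Fin (m + 1), LorDSM p (y + p 0) i.succ =
      lorIP y y - 2 * lorIP y (w i) + lorIP (w i : Fin (m + r + 3) → ℝ) (w i) := by
    intro i
    rw [← lorIP_sub_self, LorDSM]
    congr 1 <;> simp only [w] <;> abel
  have hGy : (G fun i => (LorDSM p (y + p 0) 0 - LorDSM p (y + p 0) i.succ +
      lorIP (w i : Fin (m + r + 3) → ℝ) (w i)) / 2) = fun j : Fin (m + 1) =>
        x ⟨(j : ℕ) + 1, by omega⟩ := by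
    rw [← funext hyb, ← hG]
    congr 1
    funext i
    rw [hL0, hLs]; ring
  change _ = targetEquiv _ G (LorDSM p (y + p 0))
  funext i
  refine Fin.lastCases ?_ (fun i => ?_) i
  · simp only [targetEquiv, Equiv.coe_fn_mk, Fin.snoc_last]
    rw [hGy, hL0, hy, hT, lorIP_lightConeEquiv_self]
    simp only [lightNormalForm, Fin.val_last, lt_irrefl, dite_false]
    have htail : (∑ j : Fin (m + r + 3), if m + 1 + 1 ≤ (j : ℕ) then x j ^ 2 else 0) =
        ∑ i : Fin (m + r + 1), if m ≤ (i : ℕ) then x i.succ.succ ^ 2 else 0 := by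
      rw [Fin.sum_univ_succ, Fin.sum_univ_succ, if_neg (by simp), if_neg (by simp), zero_add,
        zero_add]
      simp only [Fin.val_succ, add_le_add_iff_right]
    rw [htail, sum_fin_eq_add_tail (by omega : m ≤ m + r + 1) fun i => x i.succ.succ ^ 2,
      add_comm (∑ j : Fin m, _), ← add_assoc]
    exact (add_sub_cancel_right _ _).symm
  · simp only [targetEquiv, Equiv.coe_fn_mk, Fin.snoc_castSucc]
    rw [hGy]
    exact dif_pos i.2

theorem theorem1_1c (k n : ℕ) (hk : 1 ≤ k) (hkn : k < n)
    (p : Fin (k + 1) → Fin (n + 1) → ℝ)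
    (hgen : Module.finrank ℝ (recSub p) = k) :
    AEquiv (LorDSM p)
        (fun (x : Fin (n + 1) → ℝ) (i : Fin (k + 1)) =>
          if h : (i : ℕ) < k then x ⟨(i : ℕ) + 1, by omega⟩
          else x 0 * x ⟨1, by omega⟩
            + ∑ j : Fin (n + 1), if k + 1 ≤ (j : ℕ) then x j ^ 2 else 0)
      ↔ LLightLike (recSub p) := by
  change AEquiv (LorDSM p) (lightNormalForm k n hk hkn) ↔ _
  constructor
  · intro h
    by_contra hV
    exact lightNormalForm_not_injOn_singular k n hk hkn
      (h.injOn_singular (LorDSM_contDiff p) (LorDSM_injOn_singular hgen hV))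
  · intro hV
    obtain ⟨m, rfl⟩ := Nat.exists_eq_add_of_le' hk
    obtain ⟨r, rfl⟩ : ∃ r, n = m + r + 2 := ⟨n - m - 2, by omega⟩
    exact hV.aEquiv_lightNormalForm hgen
end
end

section
/- Let n ≥ 2 be an integer and let p₀,…,p_{n−1} ∈ ℝ^{1,n} be n points in general position. Then there exists a C∞ diffeomorphism h : ℝ^{1,n} → ℝ^{1,n} such that for every regular value y of L_{(p₀,…,p_{n−1})}, the image h(L_{(p₀,…,p_{n−1})}^{−1}(y)) of the non-singular fiber is a circle, if and only if the recognition subspace V(p₀,…,p_{n−1}) is time-like. -/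
open scoped BigOperators

noncomputable section

/-- `y` is a regular value of `f`: the differential of `f` is surjective at
every point of the fiber `f⁻¹(y)`. -/
def IsRegularValue {a b : ℕ} (f : (Fin a → ℝ) → (Fin b → ℝ)) (y : Fin b → ℝ) : Prop :=
  ∀ x, f x = y → Function.Surjective ⇑(fderiv ℝ f x)

/-- `S` is a circle in `Fin m → ℝ` (for the Euclidean structure). -/
def IsCircle {m : ℕ} (S : Set (Fin m → ℝ)) : Prop :=
  ∃ (c e₁ e₂ : Fin m → ℝ) (r : ℝ), 0 < r ∧
    eucIP e₁ e₁ = 1 ∧ eucIP e₂ e₂ = 1 ∧ eucIP e₁ e₂ = 0 ∧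
    S = {x | ∃ θ : ℝ, x = c + (r * Real.cos θ) • e₁ + (r * Real.sin θ) • e₂}

/-- The Lorentzian inner product as a bilinear form. -/
def lorForm (n : ℕ) : LinearMap.BilinForm ℝ (Fin (n + 1) → ℝ) :=
  LinearMap.mk₂ ℝ lorIP
    (fun x y z => by simp only [lorIP, Pi.add_apply, add_mul, Finset.sum_add_distrib]; ring)
    (fun c x y => by
      simp only [lorIP, Pi.smul_apply, smul_eq_mul, mul_assoc, ← Finset.mul_sum]; ring)
    (fun x y z => by simp only [lorIP, Pi.add_apply, mul_add, Finset.sum_add_distrib]; ring)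
    (fun c x y => by
      simp only [lorIP, Pi.smul_apply, smul_eq_mul, mul_left_comm _ c, ← Finset.mul_sum]; ring)

theorem lorForm_apply {n : ℕ} (x y : Fin (n + 1) → ℝ) : lorForm n x y = lorIP x y := rfl

theorem lorForm_eq_sum_succ {n : ℕ} (x y : Fin (n + 1) → ℝ) :
    lorForm n x y = (∑ i : Fin n, x i.succ * y i.succ) - x 0 * y 0 := by
  rw [lorForm_apply, lorIP, Fin.sum_univ_succ]; ring

theorem lorForm_comm {n : ℕ} (x y : Fin (n + 1) → ℝ) : lorForm n x y = lorForm n y x := by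
  simp only [lorForm_eq_sum_succ, mul_comm]

theorem lorForm_isRefl (n : ℕ) : (lorForm n).IsRefl := fun x y h => by
  rw [lorForm_comm]; exact h

theorem lorForm_single {n : ℕ} (x : Fin (n + 1) → ℝ) (j : Fin (n + 1)) :
    lorForm n x (Pi.single j 1) = if j = 0 then -x 0 else x j := by
  rcases Fin.eq_zero_or_eq_succ j with rfl | ⟨j, rfl⟩
  · simp [lorForm_eq_sum_succ]
  · simp [lorForm_eq_sum_succ, Pi.single_apply]

theorem lorForm_nondegenerate (n : ℕ) : (lorForm n).Nondegenerate := by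
  have key : ∀ x : Fin (n + 1) → ℝ, (∀ y, lorForm n x y = 0) → x = 0 := by
    intro x hx
    funext j
    have := hx (Pi.single j 1)
    rw [lorForm_single] at this
    split_ifs at this with hj
    · subst hj; simpa using this
    · exact this
  exact ⟨key, fun x hx => key x fun y => by rw [lorForm_comm]; exact hx y⟩

/-- A vector orthogonal to the time axis is space-like. -/
theorem lorForm_self_pos_of_apply_zero {n : ℕ} {w : Fin (n + 1) → ℝ} (h0 : w 0 = 0)
    (hw : w ≠ 0) : 0 < lorForm n w w := by
  rw [lorForm_eq_sum_succ, h0, mul_zero, sub_zero]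
  obtain ⟨j, hj⟩ := Function.ne_iff.mp hw
  rcases Fin.eq_zero_or_eq_succ j with rfl | ⟨j, rfl⟩
  · exact absurd h0 hj
  · exact Finset.sum_pos' (fun i _ => mul_self_nonneg _)
      ⟨j, Finset.mem_univ _, mul_self_pos.mpr hj⟩

/-- A nonzero vector orthogonal to a time-like vector is space-like. -/
theorem lorForm_self_pos_of_orthogonal {n : ℕ} {v w : Fin (n + 1) → ℝ}
    (hv : lorForm n v v < 0) (hvw : lorForm n v w = 0) (hw : w ≠ 0) : 0 < lorForm n w w := by
  by_cases h0 : w 0 = 0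
  · exact lorForm_self_pos_of_apply_zero h0 hw
  rw [lorForm_eq_sum_succ] at *
  have cs := Finset.sum_mul_sq_le_sq_mul_sq Finset.univ
    (fun i : Fin n => v i.succ) (fun i : Fin n => w i.succ)
  simp only [sq] at cs
  rw [sub_eq_zero.mp hvw] at cs
  by_contra! hneg
  have hv' : 0 ≤ ∑ i : Fin n, v i.succ * v i.succ :=
    Finset.sum_nonneg fun i _ => mul_self_nonneg _
  have hw0 : 0 < w 0 * w 0 := mul_self_pos.mpr h0
  nlinarith [mul_le_mul_of_nonneg_left (sub_nonpos.mp hneg) hv',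
    mul_lt_mul_of_pos_right (sub_neg.mp hv) hw0]

/-- If a subspace is not time-like, its orthogonal complement is not space-like. -/
theorem exists_mem_orthogonal_lorForm_nonpos {n : ℕ} {V : Submodule ℝ (Fin (n + 1) → ℝ)}
    (hV : ¬ LTimeLike V) :
    ∃ w ∈ (lorForm n).orthogonal V, w ≠ 0 ∧ lorForm n w w ≤ 0 := by
  by_cases hd : Disjoint V ((lorForm n).orthogonal V)
  · have hc := (LinearMap.BilinForm.isCompl_orthogonal_iff_disjoint (lorForm_isRefl n)).mpr hd
    have he : (Pi.single 0 1 : Fin (n + 1) → ℝ) ∈ V ⊔ (lorForm n).orthogonal V := by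
      rw [hc.sup_eq_top]; trivial
    obtain ⟨v, hv, w, hw, hvw⟩ := Submodule.mem_sup.mp he
    have h1 : lorForm n (v + w) (v + w) = -1 := by rw [hvw, lorForm_single]; simp
    have h2 : lorForm n v w = 0 := hw v hv
    have h3 : 0 ≤ lorForm n v v := not_lt.mp fun h => hV ⟨v, hv, h⟩
    simp only [map_add, LinearMap.add_apply, lorForm_comm w v, h2] at h1
    refine ⟨w, hw, ?_, by linarith⟩
    rintro rfl
    simp at h1
    linarith
  · rw [Submodule.disjoint_def] at hd
    push Not at hd
    obtain ⟨w, hwV, hw, hw0⟩ := hd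
    exact ⟨w, hw, hw0, (hw w hwV).le⟩

/-- A linear functional on a subspace of dimension at least two has a nonzero zero. -/
theorem exists_ne_zero_mem_of_one_lt_finrank {E : Type*} [AddCommGroup E] [Module ℝ E]
    [FiniteDimensional ℝ E] {W : Submodule ℝ E} (hW : 1 < Module.finrank ℝ W)
    (φ : E →ₗ[ℝ] ℝ) : ∃ w ∈ W, w ≠ 0 ∧ φ w = 0 := by
  have h := LinearMap.ker_ne_bot_of_finrank_lt (f := φ.domRestrict W)
    (by rwa [Module.finrank_self])
  obtain ⟨w, hw, hw0⟩ := Submodule.exists_mem_ne_zero_of_ne_bot h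
  exact ⟨w, w.2, fun h => hw0 (Subtype.ext h), hw⟩

section DistanceSquared

variable {n : ℕ} (p : Fin n → Fin (n + 1) → ℝ) (o : Fin n)

theorem LorDSM_apply_eq (x : Fin (n + 1) → ℝ) (i : Fin n) :
    LorDSM p x i = LorDSM p x o - 2 * lorForm n (p i - p o) (x - p o)
      + lorForm n (p i - p o) (p i - p o) := by
  have h : x - p i = (x - p o) - (p i - p o) := by abel
  simp only [LorDSM, ← lorForm_apply]
  rw [h]
  generalize x - p o = a
  generalize p i - p o = b
  simp only [map_sub, LinearMap.sub_apply, lorForm_comm a b]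
  ring

theorem mem_orthogonal_span_iff (w : Fin (n + 1) → ℝ) :
    w ∈ (lorForm n).orthogonal (Submodule.span ℝ (Set.range fun i => p i - p o)) ↔
      ∀ i, lorForm n (p i - p o) w = 0 := by
  refine ⟨fun h i => h _ (Submodule.subset_span ⟨i, rfl⟩), fun h v hv => ?_⟩
  have hle : Submodule.span ℝ (Set.range fun i => p i - p o) ≤
      LinearMap.ker ((lorForm n).flip w) := by
    rw [Submodule.span_le]
    rintro _ ⟨i, rfl⟩
    exact h i
  exact hle hv

theorem LorDSM_eq_iff (x z : Fin (n + 1) → ℝ) :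
    LorDSM p x = LorDSM p z ↔
      lorForm n (x - p o) (x - p o) = lorForm n (z - p o) (z - p o) ∧
      x - z ∈ (lorForm n).orthogonal (Submodule.span ℝ (Set.range fun i => p i - p o)) := by
  rw [mem_orthogonal_span_iff]
  have key : ∀ i, lorForm n (p i - p o) (x - z) =
      lorForm n (p i - p o) (x - p o) - lorForm n (p i - p o) (z - p o) := fun i => by
    rw [← map_sub]; congr 1; abel
  constructor
  · intro h
    refine ⟨congrFun h o, fun i => ?_⟩
    have hi := congrFun h i
    have ho := congrFun h o
    rw [LorDSM_apply_eq p o x, LorDSM_apply_eq p o z] at hi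
    rw [key]
    linarith
  · rintro ⟨ho, h⟩
    funext i
    have ho' : LorDSM p x o = LorDSM p z o := ho
    have hi := h i
    rw [key] at hi
    rw [LorDSM_apply_eq p o x, LorDSM_apply_eq p o z]
    linarith

theorem hasFDerivAt_LorDSM (x : Fin (n + 1) → ℝ) :
    HasFDerivAt (LorDSM p) (ContinuousLinearMap.pi fun i =>
      (2 : ℝ) • LinearMap.toContinuousLinearMap (lorForm n (x - p i))) x := by
  rw [hasFDerivAt_pi']
  intro i
  have hj : ∀ j, HasFDerivAt (fun x : Fin (n + 1) → ℝ => x j - p i j)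
      (ContinuousLinearMap.proj (R := ℝ) (φ := fun _ : Fin (n + 1) => ℝ) j) x := fun j =>
    (ContinuousLinearMap.proj (R := ℝ) (φ := fun _ : Fin (n + 1) => ℝ) j).hasFDerivAt.sub_const _
  have h := (HasFDerivAt.fun_sum (u := Finset.univ) fun j _ => (hj j).mul (hj j)).sub
    (((hj 0).mul (hj 0)).const_mul 2)
  refine h.congr_fderiv ?_
  ext v
  simp [lorForm_apply, lorIP, Finset.sum_add_distrib, sub_mul, Finset.sum_sub_distrib]
  ring

theorem surjective_fderiv_LorDSM_iff
    (hgen : Module.finrank ℝ (Submodule.span ℝ (Set.range fun i => p i - p o)) = n - 1)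
    (x : Fin (n + 1) → ℝ) :
    Function.Surjective (fderiv ℝ (LorDSM p) x) ↔
      x - p o ∉ Submodule.span ℝ (Set.range fun i => p i - p o) := by
  have hn : 0 < n := o.pos
  set V := Submodule.span ℝ (Set.range fun i => p i - p o)
  rw [(hasFDerivAt_LorDSM p x).fderiv]
  set D := ContinuousLinearMap.pi fun i =>
      (2 : ℝ) • LinearMap.toContinuousLinearMap (lorForm n (x - p i)) with hD
  have hker : LinearMap.ker (D : (Fin (n + 1) → ℝ) →ₗ[ℝ] (Fin n → ℝ)) =
      (lorForm n).orthogonal (V ⊔ Submodule.span ℝ {x - p o}) := by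
    ext v
    have hDv : ∀ i, D v i = 2 * lorForm n (x - p i) v := fun i => by simp [hD]
    have hsub : ∀ i, lorForm n (x - p i) v =
        lorForm n (x - p o) v - lorForm n (p i - p o) v := fun i => by
      rw [← LinearMap.sub_apply, ← map_sub]; congr 2; abel
    have hmem : v ∈ (lorForm n).orthogonal (V ⊔ Submodule.span ℝ {x - p o}) ↔
        (∀ i, lorForm n (p i - p o) v = 0) ∧ lorForm n (x - p o) v = 0 := by
      rw [← mem_orthogonal_span_iff]
      constructor
      · intro h
        exact ⟨fun u hu => h u (Submodule.mem_sup_left hu),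
          h _ (Submodule.mem_sup_right (Submodule.mem_span_singleton_self _))⟩
      · rintro ⟨h1, h2⟩ u hu
        obtain ⟨a, ha, b, hb, rfl⟩ := Submodule.mem_sup.mp hu
        obtain ⟨c, rfl⟩ := Submodule.mem_span_singleton.mp hb
        have h1' : lorForm n a v = 0 := h1 a ha
        rw [map_add, map_smul, LinearMap.add_apply, LinearMap.smul_apply, h1', h2, smul_zero,
          add_zero]
    rw [hmem, LinearMap.mem_ker]
    constructor
    · intro h
      have h' : ∀ i, lorForm n (x - p i) v = 0 := fun i => by
        have := congrFun h i
        have h2 := hDv i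
        simp only [ContinuousLinearMap.coe_coe, Pi.zero_apply] at this
        linarith
      refine ⟨fun i => ?_, h' o⟩
      have := hsub i
      rw [h', h'] at this
      linarith
    · rintro ⟨h1, h2⟩
      funext i
      simp only [ContinuousLinearMap.coe_coe, Pi.zero_apply]
      rw [hDv, hsub, h1, h2]
      ring
  have hrank := LinearMap.finrank_range_add_finrank_ker
    (D : (Fin (n + 1) → ℝ) →ₗ[ℝ] (Fin n → ℝ))
  rw [hker, LinearMap.BilinForm.finrank_orthogonal (lorForm_nondegenerate n),
    Module.finrank_fin_fun] at hrank
  have hsurj : Function.Surjective D ↔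
      Module.finrank ℝ (LinearMap.range (D : (Fin (n + 1) → ℝ) →ₗ[ℝ] (Fin n → ℝ))) = n := by
    have hs : Function.Surjective D ↔
        LinearMap.range (D : (Fin (n + 1) → ℝ) →ₗ[ℝ] (Fin n → ℝ)) = ⊤ :=
      LinearMap.range_eq_top.symm
    rw [hs]
    constructor
    · intro h; rw [h, finrank_top, Module.finrank_fin_fun]
    · intro h; exact Submodule.eq_top_of_finrank_eq (by rw [h, Module.finrank_fin_fun])
  rw [hsurj]
  by_cases hx : x - p o ∈ V
  · rw [sup_eq_left.mpr ((Submodule.span_singleton_le_iff_mem _ _).mpr hx), hgen] at hrank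
    simp only [hx, not_true, iff_false]
    omega
  · have h0 : x - p o ≠ 0 := fun h => hx (h ▸ V.zero_mem)
    have hdisj : V ⊓ Submodule.span ℝ {x - p o} = ⊥ :=
      ((Submodule.disjoint_span_singleton' h0).mpr hx).eq_bot
    have := Submodule.finrank_sup_add_finrank_inf_eq V (Submodule.span ℝ {x - p o})
    rw [hdisj, finrank_bot, hgen, finrank_span_singleton h0] at this
    simp only [hx, not_false_iff, iff_true]
    omega

end DistanceSquared

/-- A linear functional is bounded above on a set that a homeomorphism carries to a circle. -/
theorem exists_le_of_isCircle_image {m : ℕ} {h : (Fin m → ℝ) ≃ (Fin m → ℝ)}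
    (hh : Continuous h.symm) {F : Set (Fin m → ℝ)} (hF : IsCircle (h '' F))
    (φ : (Fin m → ℝ) →ₗ[ℝ] ℝ) : ∃ C, ∀ x ∈ F, φ x ≤ C := by
  obtain ⟨c, e₁, e₂, r, -, -, -, -, hS⟩ := hF
  set g : ℝ × ℝ → Fin m → ℝ := fun t => c + (r * t.1) • e₁ + (r * t.2) • e₂ with hg
  have hgc : Continuous fun t => φ (h.symm (g t)) := by
    have h1 : Continuous g := by fun_prop
    exact φ.continuous_of_finiteDimensional.comp (hh.comp h1)
  obtain ⟨C, hC⟩ := ((isCompact_Icc.prod isCompact_Icc).image hgc).bddAbove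
    (s := (fun t => φ (h.symm (g t))) '' (Set.Icc (-1 : ℝ) 1 ×ˢ Set.Icc (-1 : ℝ) 1))
  refine ⟨C, fun x hx => hC ?_⟩
  have hx' : h x ∈ h '' F := ⟨x, hx, rfl⟩
  rw [hS] at hx'
  obtain ⟨θ, hθ⟩ := hx'
  refine ⟨(Real.cos θ, Real.sin θ), ⟨⟨Real.neg_one_le_cos θ, Real.cos_le_one θ⟩,
    ⟨Real.neg_one_le_sin θ, Real.sin_le_one θ⟩⟩, ?_⟩
  simp only [hg, ← hθ, Equiv.symm_apply_apply]

/-- If every value `c + b * q` with `q > 0` is attained by a functional on a set, no homeomorphism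
carries that set to a circle. -/
theorem not_isCircle_image_of_unbounded {m : ℕ} {h : (Fin m → ℝ) ≃ (Fin m → ℝ)}
    (hh : Continuous h.symm) {F : Set (Fin m → ℝ)} (φ : (Fin m → ℝ) →ₗ[ℝ] ℝ) {c q : ℝ}
    (hq : 0 < q) (hφ : ∀ b : ℝ, ∃ x ∈ F, φ x = c + b * q) : ¬ IsCircle (h '' F) := by
  intro hF
  obtain ⟨C, hC⟩ := exists_le_of_isCircle_image hh hF φ
  obtain ⟨x, hx, hxb⟩ := hφ ((C - c + 1) / q)
  have := hC x hx
  rw [hxb, div_mul_cancel₀ _ hq.ne'] at this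
  linarith

section NotTimeLike

variable {n : ℕ} (p : Fin n → Fin (n + 1) → ℝ) (o : Fin n)

theorem finrank_orthogonal_span
    (hgen : Module.finrank ℝ (Submodule.span ℝ (Set.range fun i => p i - p o)) = n - 1) :
    Module.finrank ℝ ((lorForm n).orthogonal
      (Submodule.span ℝ (Set.range fun i => p i - p o))) = 2 := by
  rw [LinearMap.BilinForm.finrank_orthogonal (lorForm_nondegenerate n), hgen,
    Module.finrank_fin_fun]
  have := o.pos
  omega

/-- When the orthogonal complement of the recognition subspace contains a time-like vector, some
regular fiber is a hyperbola. -/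
theorem exists_regular_unbounded_of_neg
    (hgen : Module.finrank ℝ (Submodule.span ℝ (Set.range fun i => p i - p o)) = n - 1)
    {w : Fin (n + 1) → ℝ}
    (hw : w ∈ (lorForm n).orthogonal (Submodule.span ℝ (Set.range fun i => p i - p o)))
    (hneg : lorForm n w w < 0) :
    ∃ z, IsRegularValue (LorDSM p) (LorDSM p z) ∧
      ∃ (φ : (Fin (n + 1) → ℝ) →ₗ[ℝ] ℝ) (c q : ℝ), 0 < q ∧
        ∀ b : ℝ, ∃ x ∈ LorDSM p ⁻¹' {LorDSM p z}, φ x = c + b * q := by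
  obtain ⟨w', hw', hw'0, hww'⟩ := exists_ne_zero_mem_of_one_lt_finrank
    (by rw [finrank_orthogonal_span p o hgen]; norm_num) (lorForm n w)
  have hpos := lorForm_self_pos_of_orthogonal hneg hww' hw'0
  refine ⟨p o + w, ?_, lorForm n w', lorForm n w' (p o), lorForm n w' w', hpos, fun b => ?_⟩
  · intro x hx
    rw [LorDSM_eq_iff p o] at hx
    rw [surjective_fderiv_LorDSM_iff p o hgen]
    intro hxV
    have hxo : x - p o ∈
        (lorForm n).orthogonal (Submodule.span ℝ (Set.range fun i => p i - p o)) := by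
      have := Submodule.add_mem _ hx.2 hw
      convert this using 1; abel
    have h0 : lorForm n (x - p o) (x - p o) = 0 := hxo _ hxV
    rw [hx.1, add_sub_cancel_left] at h0
    linarith
  · set a := Real.sqrt (1 + b ^ 2 * (lorForm n w' w' / -lorForm n w w)) with ha
    have ha2 : a ^ 2 = 1 + b ^ 2 * (lorForm n w' w' / -lorForm n w w) := by
      rw [ha, Real.sq_sqrt]
      have : 0 ≤ lorForm n w' w' / -lorForm n w w := div_nonneg hpos.le (by linarith)
      positivity
    have ha3 : a ^ 2 * lorForm n w w = lorForm n w w - b ^ 2 * lorForm n w' w' := by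
      have hne := hneg.ne
      rw [ha2]; field_simp; ring
    refine ⟨p o + (a • w + b • w'), ?_, ?_⟩
    · rw [Set.mem_preimage, Set.mem_singleton_iff, LorDSM_eq_iff p o]
      constructor
      · simp only [add_sub_cancel_left, map_add, map_smul, LinearMap.add_apply,
          LinearMap.smul_apply, smul_eq_mul, hww', lorForm_comm w' w]
        linarith
      · rw [add_sub_add_left_eq_sub]
        exact Submodule.sub_mem _ (Submodule.add_mem _ (Submodule.smul_mem _ _ hw)
          (Submodule.smul_mem _ _ hw')) hw
    · simp [lorForm_comm w' w, hww']

/-- When the recognition subspace is degenerate, some regular fiber is a parabola. -/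
theorem exists_regular_unbounded_of_null
    (hgen : Module.finrank ℝ (Submodule.span ℝ (Set.range fun i => p i - p o)) = n - 1)
    {u : Fin (n + 1) → ℝ} (huV : u ∈ Submodule.span ℝ (Set.range fun i => p i - p o))
    (hu : u ∈ (lorForm n).orthogonal (Submodule.span ℝ (Set.range fun i => p i - p o)))
    (hu0 : u ≠ 0) :
    ∃ z, IsRegularValue (LorDSM p) (LorDSM p z) ∧
      ∃ (φ : (Fin (n + 1) → ℝ) →ₗ[ℝ] ℝ) (c q : ℝ), 0 < q ∧
        ∀ b : ℝ, ∃ x ∈ LorDSM p ⁻¹' {LorDSM p z}, φ x = c + b * q := by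
  obtain ⟨w, hw, hw0, hwt⟩ := exists_ne_zero_mem_of_one_lt_finrank
    (by rw [finrank_orthogonal_span p o hgen]; norm_num)
    (LinearMap.proj (R := ℝ) (φ := fun _ : Fin (n + 1) => ℝ) 0)
  have hpos := lorForm_self_pos_of_apply_zero hwt hw0
  obtain ⟨k, hk⟩ : ∃ k, lorForm n u k ≠ 0 := by
    by_contra! h
    exact hu0 ((lorForm_nondegenerate n).1 u h)
  have huw : lorForm n u w = 0 := hw u huV
  have huu : lorForm n u u = 0 := hu u huV
  refine ⟨p o + k, ?_, lorForm n w, lorForm n w (p o + k), lorForm n w w, hpos, fun b => ?_⟩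
  · intro x hx
    rw [LorDSM_eq_iff p o] at hx
    rw [surjective_fderiv_LorDSM_iff p o hgen]
    intro hxV
    have h1 : lorForm n (x - p o) u = 0 := hu _ hxV
    have h2 : lorForm n u (x - (p o + k)) = 0 := hx.2 u huV
    rw [lorForm_comm, ← sub_add_cancel (x - p o) k, sub_sub, map_add, h2, zero_add] at h1
    exact hk h1
  · set t := -(2 * b * lorForm n w k + b ^ 2 * lorForm n w w) / (2 * lorForm n u k) with ht
    have ht' : 2 * t * lorForm n u k = -(2 * b * lorForm n w k + b ^ 2 * lorForm n w w) := by
      rw [ht]; field_simp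
    refine ⟨p o + k + (b • w + t • u), ?_, ?_⟩
    · rw [Set.mem_preimage, Set.mem_singleton_iff, LorDSM_eq_iff p o]
      constructor
      · rw [add_assoc, add_sub_cancel_left, add_sub_cancel_left]
        simp only [map_add, map_smul, LinearMap.add_apply, LinearMap.smul_apply, smul_eq_mul,
          huw, huu, lorForm_comm w u, lorForm_comm k u, lorForm_comm k w]
        linarith
      · rw [add_sub_cancel_left]
        exact Submodule.add_mem _ (Submodule.smul_mem _ _ hw) (Submodule.smul_mem _ _ hu)
    · simp [lorForm_comm w u, huw]

theorem exists_regular_unbounded_of_not_timeLike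
    (hgen : Module.finrank ℝ (Submodule.span ℝ (Set.range fun i => p i - p o)) = n - 1)
    (hV : ¬ LTimeLike (Submodule.span ℝ (Set.range fun i => p i - p o))) :
    ∃ z, IsRegularValue (LorDSM p) (LorDSM p z) ∧
      ∃ (φ : (Fin (n + 1) → ℝ) →ₗ[ℝ] ℝ) (c q : ℝ), 0 < q ∧
        ∀ b : ℝ, ∃ x ∈ LorDSM p ⁻¹' {LorDSM p z}, φ x = c + b * q := by
  obtain ⟨w, hw, hw0, hle⟩ := exists_mem_orthogonal_lorForm_nonpos hV
  rcases hle.lt_or_eq with hlt | heq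
  · exact exists_regular_unbounded_of_neg p o hgen hw hlt
  by_cases hwV : w ∈ Submodule.span ℝ (Set.range fun i => p i - p o)
  · exact exists_regular_unbounded_of_null p o hgen hwV hw hw0
  obtain ⟨k, hk, hwk⟩ : ∃ k ∈ (lorForm n).orthogonal
      (Submodule.span ℝ (Set.range fun i => p i - p o)), lorForm n k w ≠ 0 := by
    by_contra! h
    apply hwV
    rw [← LinearMap.BilinForm.orthogonal_orthogonal (lorForm_nondegenerate n) (lorForm_isRefl n)
      (Submodule.span ℝ (Set.range fun i => p i - p o))]
    exact h
  refine exists_regular_unbounded_of_neg p o hgen (w := k +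
    (-(lorForm n k k + 1) / (2 * lorForm n k w)) • w)
    (Submodule.add_mem _ hk (Submodule.smul_mem _ _ hw)) ?_
  have : lorForm n (k + (-(lorForm n k k + 1) / (2 * lorForm n k w)) • w)
      (k + (-(lorForm n k k + 1) / (2 * lorForm n k w)) • w) = -1 := by
    simp only [map_add, map_smul, LinearMap.add_apply, LinearMap.smul_apply, smul_eq_mul, heq,
      lorForm_comm w k]
    field_simp
    ring
  linarith

end NotTimeLike

/-- A positive definite plane for the Lorentzian form has an orthonormal basis. -/
theorem exists_orthonormal_of_finrank_eq_two {n : ℕ} {W : Submodule ℝ (Fin (n + 1) → ℝ)}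
    (hW : Module.finrank ℝ W = 2) (hpos : ∀ w ∈ W, w ≠ 0 → 0 < lorForm n w w) :
    ∃ w₁ ∈ W, ∃ w₂ ∈ W, lorForm n w₁ w₁ = 1 ∧ lorForm n w₂ w₂ = 1 ∧ lorForm n w₁ w₂ = 0 ∧
      LinearIndependent ℝ ![w₁, w₂] ∧ ∀ w ∈ W, ∃ a b : ℝ, w = a • w₁ + b • w₂ := by
  have unit : ∀ φ : (Fin (n + 1) → ℝ) →ₗ[ℝ] ℝ, ∃ w ∈ W, lorForm n w w = 1 ∧ φ w = 0 := by
    intro φ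
    obtain ⟨w, hw, hw0, hφ⟩ := exists_ne_zero_mem_of_one_lt_finrank (W := W) (by omega) φ
    have hp := hpos w hw hw0
    refine ⟨(Real.sqrt (lorForm n w w))⁻¹ • w, W.smul_mem _ hw, ?_, by simp [hφ]⟩
    simp only [map_smul, LinearMap.smul_apply, smul_eq_mul]
    rw [← mul_assoc, ← mul_inv, Real.mul_self_sqrt hp.le, inv_mul_cancel₀ hp.ne']
  obtain ⟨w₁, hw₁, h11, -⟩ := unit 0
  obtain ⟨w₂, hw₂, h22, h12⟩ := unit (lorForm n w₁)
  have hli : LinearIndependent ℝ ![w₁, w₂] := by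
    rw [LinearIndependent.pair_iff]
    intro s t hst
    have h1 := congrArg (lorForm n w₁) hst
    have h2 := congrArg (lorForm n w₂) hst
    simp [h11, h12, h22, lorForm_comm w₂ w₁] at h1 h2
    exact ⟨h1, h2⟩
  have hspan : Submodule.span ℝ (Set.range ![w₁, w₂]) = W := by
    apply Submodule.eq_of_le_of_finrank_eq
    · rw [Submodule.span_le]
      rintro _ ⟨i, rfl⟩
      fin_cases i <;> assumption
    · rw [finrank_span_eq_card hli, hW, Fintype.card_fin]
  refine ⟨w₁, hw₁, w₂, hw₂, h11, h22, h12, hli, fun w hw => ?_⟩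
  rw [← hspan, Matrix.range_cons_cons_empty, Submodule.mem_span_pair] at hw
  obtain ⟨a, b, h⟩ := hw
  exact ⟨a, b, h.symm⟩

/-- A linear automorphism carrying two independent vectors to Euclidean orthonormal ones. -/
theorem exists_linearEquiv_eucIP_orthonormal {m : ℕ} {w₁ w₂ : Fin m → ℝ}
    (hli : LinearIndependent ℝ ![w₁, w₂]) :
    ∃ h : (Fin m → ℝ) ≃ₗ[ℝ] (Fin m → ℝ), eucIP (h w₁) (h w₁) = 1 ∧
      eucIP (h w₂) (h w₂) = 1 ∧ eucIP (h w₁) (h w₂) = 0 := by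
  classical
  let b := Module.Basis.sumExtend hli
  let e := b.indexEquiv (Pi.basisFun ℝ (Fin m))
  let h := (b.reindex e).equivFun
  have hb : ∀ i, h (![w₁, w₂] i) = Pi.single (e (Sum.inl i)) 1 := by
    intro i
    have h1 : (b.reindex e) (e (Sum.inl i)) = ![w₁, w₂] i := by
      simp [b, Module.Basis.sumExtend]
      rfl
    rw [← h1]
    funext j
    simp [h, Finsupp.single_eq_pi_single]
  have h1 : h w₁ = Pi.single (e (Sum.inl 0)) 1 := hb 0
  have h2 : h w₂ = Pi.single (e (Sum.inl 1)) 1 := hb 1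
  refine ⟨h, ?_, ?_, ?_⟩ <;> simp [h1, h2, eucIP, Pi.single_apply]

theorem isCircle_image_of_timeLike {n : ℕ} (p : Fin n → Fin (n + 1) → ℝ) (o : Fin n)
    (hgen : Module.finrank ℝ (Submodule.span ℝ (Set.range fun i => p i - p o)) = n - 1)
    (hV : LTimeLike (Submodule.span ℝ (Set.range fun i => p i - p o))) :
    ∃ h : (Fin (n + 1) → ℝ) ≃ₗ[ℝ] (Fin (n + 1) → ℝ), ∀ z,
      IsRegularValue (LorDSM p) (LorDSM p z) →
        IsCircle (h '' (LorDSM p ⁻¹' {LorDSM p z})) := by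
  obtain ⟨v, hv, hvneg⟩ := hV
  have hpos : ∀ w ∈ (lorForm n).orthogonal (Submodule.span ℝ (Set.range fun i => p i - p o)),
      w ≠ 0 → 0 < lorForm n w w := fun w hw hw0 =>
    lorForm_self_pos_of_orthogonal hvneg (hw v hv) hw0
  have hcompl : IsCompl (Submodule.span ℝ (Set.range fun i => p i - p o))
      ((lorForm n).orthogonal (Submodule.span ℝ (Set.range fun i => p i - p o))) := by
    rw [LinearMap.BilinForm.isCompl_orthogonal_iff_disjoint (lorForm_isRefl n),
      Submodule.disjoint_def]
    intro w hwV hw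
    by_contra hw0
    exact (hpos w hw hw0).ne' (hw w hwV)
  obtain ⟨w₁, hw₁, w₂, hw₂, h11, h22, h12, hli, hbasis⟩ :=
    exists_orthonormal_of_finrank_eq_two (finrank_orthogonal_span p o hgen) hpos
  obtain ⟨h, he1, he2, he12⟩ := exists_linearEquiv_eucIP_orthonormal hli
  refine ⟨h, fun z hz => ?_⟩
  have hzsup : z - p o ∈ Submodule.span ℝ (Set.range fun i => p i - p o) ⊔
      (lorForm n).orthogonal (Submodule.span ℝ (Set.range fun i => p i - p o)) := by
    rw [hcompl.sup_eq_top]; trivial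
  obtain ⟨u, hu, w, hw, huw⟩ := Submodule.mem_sup.mp hzsup
  have hw0 : w ≠ 0 := by
    rintro rfl
    have := (surjective_fderiv_LorDSM_iff p o hgen z).mp (hz z rfl)
    rw [← huw, add_zero] at this
    exact this hu
  have hQ := hpos w hw hw0
  have hsplit : ∀ k ∈ (lorForm n).orthogonal (Submodule.span ℝ (Set.range fun i => p i - p o)),
      lorForm n (u + k) (u + k) = lorForm n u u + lorForm n k k := by
    intro k hk
    have huk : lorForm n u k = 0 := hk u hu
    simp [lorForm_comm k u, huk]
  have hplane : ∀ a b : ℝ, lorForm n (a • w₁ + b • w₂) (a • w₁ + b • w₂) = a ^ 2 + b ^ 2 := by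
    intro a b
    simp [h11, h12, h22, lorForm_comm w₂ w₁]
    ring
  set r := Real.sqrt (lorForm n w w) with hr
  have hr0 : 0 < r := Real.sqrt_pos.mpr hQ
  have hr2 : r ^ 2 = lorForm n w w := Real.sq_sqrt hQ.le
  refine ⟨h (p o + u), h w₁, h w₂, r, hr0, he1, he2, he12, ?_⟩
  have hfiber : ∀ x, x ∈ LorDSM p ⁻¹' {LorDSM p z} ↔
      ∃ θ : ℝ, x = p o + u + ((r * Real.cos θ) • w₁ + (r * Real.sin θ) • w₂) := by
    intro x
    rw [Set.mem_preimage, Set.mem_singleton_iff, LorDSM_eq_iff p o, ← huw, hsplit w hw]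
    constructor
    · rintro ⟨hx1, hx2⟩
      have hk : x - p o - u ∈
          (lorForm n).orthogonal (Submodule.span ℝ (Set.range fun i => p i - p o)) := by
        have hxz : x - p o - u = (x - z) + w := by
          have : z = p o + (u + w) := by rw [huw]; abel
          rw [this]; abel
        rw [hxz]
        exact Submodule.add_mem _ hx2 hw
      obtain ⟨a, b, hab⟩ := hbasis _ hk
      have hx3 : x - p o = u + (a • w₁ + b • w₂) := by rw [← hab]; abel
      rw [hx3, hsplit _ (hab ▸ hk), hplane, ← hr2] at hx1
      have hab2 : a ^ 2 + b ^ 2 = r ^ 2 := by linarith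
      let ζ : ℂ := ⟨a, b⟩
      have hζ : ‖ζ‖ = r := by
        rw [Complex.norm_def, Complex.normSq_mk, ← sq, ← sq, hab2, Real.sqrt_sq hr0.le]
      refine ⟨Complex.arg ζ, ?_⟩
      rw [← hζ, Complex.norm_mul_cos_arg, Complex.norm_mul_sin_arg, add_assoc, ← hx3]
      abel
    · rintro ⟨θ, rfl⟩
      have hmem : (r * Real.cos θ) • w₁ + (r * Real.sin θ) • w₂ ∈
          (lorForm n).orthogonal (Submodule.span ℝ (Set.range fun i => p i - p o)) :=
        Submodule.add_mem _ (Submodule.smul_mem _ _ hw₁) (Submodule.smul_mem _ _ hw₂)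
      constructor
      · rw [add_assoc, add_sub_cancel_left, hsplit _ hmem, hplane, ← hr2]
        linear_combination r ^ 2 * Real.cos_sq_add_sin_sq θ
      · have : z = p o + u + w := by rw [add_assoc, huw]; abel
        rw [this, add_sub_add_left_eq_sub]
        exact Submodule.sub_mem _ hmem hw
  ext x
  constructor
  · rintro ⟨y, hy, rfl⟩
    obtain ⟨θ, rfl⟩ := (hfiber y).mp hy
    exact ⟨θ, by simp only [map_add, map_smul, add_assoc]⟩
  · rintro ⟨θ, rfl⟩
    exact ⟨_, (hfiber _).mpr ⟨θ, rfl⟩, by simp only [map_add, map_smul, add_assoc]⟩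

theorem corollary1_1 (n : ℕ) (hn : 2 ≤ n) (p : Fin n → Fin (n + 1) → ℝ)
    (hgen : Module.finrank ℝ
        (Submodule.span ℝ (Set.range fun i => p i - p ⟨0, by omega⟩)) = n - 1) :
    (∃ h : (Fin (n + 1) → ℝ) ≃ (Fin (n + 1) → ℝ),
        ContDiff ℝ (⊤ : ℕ∞) ⇑h ∧ ContDiff ℝ (⊤ : ℕ∞) ⇑h.symm ∧
        ∀ y : Fin n → ℝ, IsRegularValue (LorDSM p) y → (LorDSM p ⁻¹' {y}).Nonempty →
          IsCircle (⇑h '' (LorDSM p ⁻¹' {y})))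
      ↔ LTimeLike (Submodule.span ℝ (Set.range fun i => p i - p ⟨0, by omega⟩)) := by
  constructor
  · rintro ⟨h, -, hsymm, hcirc⟩
    by_contra hV
    obtain ⟨z, hz, φ, c, q, hq, hφ⟩ := exists_regular_unbounded_of_not_timeLike p _ hgen hV
    exact not_isCircle_image_of_unbounded hsymm.continuous φ hq hφ (hcirc _ hz ⟨z, rfl⟩)
  · intro hV
    obtain ⟨h, hh⟩ := isCircle_image_of_timeLike p _ hgen hV
    refine ⟨h.toEquiv, h.toContinuousLinearEquiv.contDiff,
      h.toContinuousLinearEquiv.symm.contDiff, ?_⟩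
    rintro y hy ⟨z, rfl⟩
    exact hh z hy
end
end
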